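/- arXiv:math/0507066 — 2 statements merged into one kernel-verified Lean document; each statement's English description precedes it below -/
import Mathlib

section
/- Let Å|_1 and Å|_2 denote the restrictions of Å to the subspaces H^{2p+2}_ℓ(ℝ^{2p+1}) (μ-independent maps) and P^{2p+2+s}_ℓ(ℝ^{2p+1}) (maps vanishing at μ = 0), and L_{B,ν}|_1, L_{B,ν}|_2 the corresponding restrictions of L_{B,ν}. Then Å|_1 and Å|_2 are projections with range Å|_1 = H^{2p+1}_ℓ(ℝ^{2p+1}, T^p), range Å|_2 = P^{2p+1+s}_ℓ(ℝ^{2p+1}, T^p), ker Å|_1 = range L_{B,ν}|_1, ker Å|_2 = range L_{B,ν}|_2, and consequently the refined direct-sum decompositions hold: H^{2p+2}_ℓ(ℝ^{2p+1}) = H^{2p+1}_ℓ(ℝ^{2p+1}, T^p) ⊕ range L_{B,ν}|_1 and P^{2p+2+s}_ℓ(ℝ^{2p+1}) = P^{2p+1+s}_ℓ(ℝ^{2p+1}, T^p) ⊕ range L_{B,ν}|_2. -/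
noncomputable section

open MeasureTheory Complex

abbrev V (p : ℕ) := ℝ × (Fin p → ℂ)
abbrev W (p s : ℕ) := V p × ℝ × (Fin s → ℝ)

/-- The torus action on `ℝ × ℂ^p`. -/
def torusAct (p : ℕ) (θ : Fin p → ℝ) (x : V p) : V p :=
  (x.1, fun j => Complex.exp (Complex.I * θ j) * x.2 j)

/-- Variable index type for real coordinates on `W p s`. -/
abbrev HVar (p s : ℕ) := (Unit ⊕ Fin p × Bool) ⊕ Unit ⊕ Fin s

/-- Real coordinates of a point of `W p s`. -/
def coordsW {p s : ℕ} (w : W p s) : HVar p s → ℝ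
  | .inl (.inl _) => w.1.1
  | .inl (.inr (j, b)) => if b then (w.1.2 j).re else (w.1.2 j).im
  | .inr (.inl _) => w.2.1
  | .inr (.inr k) => w.2.2 k

/-- `f` is a real-valued homogeneous polynomial of degree `ℓ` in coords of `W p s`. -/
def IsHomogScalar (p s ℓ : ℕ) (f : W p s → ℝ) : Prop :=
  ∃ P : MvPolynomial (HVar p s) ℝ, P.IsHomogeneous ℓ ∧
    ∀ w, f w = MvPolynomial.eval (coordsW w) P

/-- Membership in `H^{2p+2+s}_ℓ(ℝ^{2p+1})`. -/
def MemH (p s ℓ : ℕ) (f : W p s → V p) : Prop :=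
  IsHomogScalar p s ℓ (fun w => (f w).1) ∧
  ∀ j, IsHomogScalar p s ℓ (fun w => ((f w).2 j).re) ∧
       IsHomogScalar p s ℓ (fun w => ((f w).2 j).im)

/-- ν-independence. -/
def NuIndep (p s : ℕ) (f : W p s → V p) : Prop :=
  ∀ x ν ν' μ, f (x, ν, μ) = f (x, ν', μ)

/-- Torus-equivariance. -/
def Equivar (p s : ℕ) (f : W p s → V p) : Prop :=
  ∀ θ x ν μ, f (torusAct p θ x, ν, μ) = torusAct p θ (f (x, ν, μ))

/-- The linear part `B(x) = (0, iω_1 x_1, …, iω_p x_p)`. -/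
def Bmap (p : ℕ) (ω : Fin p → ℝ) (x : V p) : V p :=
  (0, fun j => Complex.I * (ω j : ℂ) * x.2 j)

/-- The homological operator `L_{B,ν}`. -/
def Lop (p s : ℕ) (ω : Fin p → ℝ) (f : W p s → V p) : W p s → V p :=
  fun w => fderiv ℝ f w (Bmap p ω w.1, 0, 0) - Bmap p ω (f w)
    + w.2.1 • fderiv ℝ f w (((1 : ℝ), (0 : Fin p → ℂ)), 0, 0)

/-- Fundamental domain for the torus. -/
def torusBox (p : ℕ) : Set (Fin p → ℝ) := Set.univ.pi fun _ => Set.Icc 0 (2 * Real.pi)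

/-- The averaging operator `Å`. -/
def Aop (p s : ℕ) (f : W p s → V p) : W p s → V p :=
  fun w => ((2 * Real.pi) ^ p)⁻¹ •
    ∫ θ in torusBox p, torusAct p θ (f (torusAct p (-θ) w.1, 0, w.2.2))

-- radial side
abbrev VZ (p : ℕ) := ℝ × (Fin p → ℝ)
abbrev WZ (p s : ℕ) := VZ p × (Fin s → ℝ)

abbrev ZVar (p s : ℕ) := (Unit ⊕ Fin p) ⊕ Fin s

def coordsZ {p s : ℕ} (w : WZ p s) : ZVar p s → ℝ
  | .inl (.inl _) => w.1.1
  | .inl (.inr j) => w.1.2 j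
  | .inr k => w.2 k

def IsHomogScalarZ (p s ℓ : ℕ) (f : WZ p s → ℝ) : Prop :=
  ∃ P : MvPolynomial (ZVar p s) ℝ, P.IsHomogeneous ℓ ∧
    ∀ w, f w = MvPolynomial.eval (coordsZ w) P

/-- Membership in `H^{p+1+s}_ℓ(ℝ^{p+1}, Z_{2,p})`. -/
def MemZ (p s ℓ : ℕ) (g : WZ p s → VZ p) : Prop :=
  (IsHomogScalarZ p s ℓ fun w => (g w).1) ∧
  (∀ j, IsHomogScalarZ p s ℓ fun w => (g w).2 j) ∧
  (∀ lam : Fin p → ℝ, (∀ j, lam j = 1 ∨ lam j = -1) →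
    ∀ ρ μ, g ((ρ.1, fun j => lam j * ρ.2 j), μ)
      = ((g (ρ, μ)).1, fun j => lam j * (g (ρ, μ)).2 j))

/-- Inclusion of real radial coordinates into `ℝ × ℂ^p`. -/
def embZ (p : ℕ) (ρ : VZ p) : V p := (ρ.1, fun j => (ρ.2 j : ℂ))

/-- The operator Π extracting the radial part. -/
def Piop (p s : ℕ) (f : W p s → V p) : WZ p s → VZ p :=
  fun w => ((f (embZ p w.1, 0, w.2)).1, fun j => ((f (embZ p w.1, 0, w.2)).2 j).re)

def MuIndep (p s : ℕ) (f : W p s → V p) : Prop :=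
  ∀ x ν μ μ', f (x, ν, μ) = f (x, ν, μ')

def VanishMu (p s : ℕ) (f : W p s → V p) : Prop :=
  ∀ x ν, f (x, ν, 0) = 0

def MuIndepZ (p s : ℕ) (g : WZ p s → VZ p) : Prop :=
  ∀ ρ μ μ', g (ρ, μ) = g (ρ, μ')

def VanishMuZ (p s : ℕ) (g : WZ p s → VZ p) : Prop :=
  ∀ ρ, g (ρ, 0) = 0

end

noncomputable section

open ComplexConjugate in
/-- The monomial `x₀^a ν^b x^m x̄^n μ^c`. -/
def mono {p s : ℕ} (a b : ℕ) (m n : Fin p → ℕ) (c : Fin s → ℕ) (w : W p s) : ℂ :=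
  (w.1.1 : ℂ) ^ a * (w.2.1 : ℂ) ^ b * (∏ j, w.1.2 j ^ m j) * (∏ j, conj (w.1.2 j) ^ n j) *
    ∏ k, (w.2.2 k : ℂ) ^ c k

/-- The complex span of the monomials of degree `ℓ` whose `μ`-exponent satisfies `T`. -/
def polySpace (p s : ℕ) (T : (Fin s → ℕ) → Prop) (ℓ : ℕ) : Submodule ℂ (W p s → ℂ) :=
  Submodule.span ℂ {F | ∃ a b m n c, a + b + ∑ j, m j + ∑ j, n j + ∑ k, c k = ℓ ∧ T c ∧
    F = mono a b m n c}

/-- The average of a scalar function against the character of weight `e`. -/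
def charAvg {p s : ℕ} (e : Fin p → ℤ) (F : W p s → ℂ) (w : W p s) : ℂ :=
  ((2 * Real.pi) ^ p : ℝ)⁻¹ • ∫ θ in torusBox p,
    Complex.exp (Complex.I * ∑ j, (e j : ℂ) * θ j) * F (torusAct p (-θ) w.1, 0, w.2.2)

/-- The homological operator on scalar functions of weight `e`. -/
def homOp {p s : ℕ} (ω : Fin p → ℝ) (e : Fin p → ℤ) (F : W p s → ℂ) (w : W p s) : ℂ :=
  fderiv ℝ F w (Bmap p ω w.1, 0, 0) - Complex.I * (∑ j, (e j : ℂ) * ω j) * F w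
    + (w.2.1 : ℂ) * fderiv ℝ F w (((1 : ℝ), (0 : Fin p → ℂ)), 0, 0)

section Scalar

open MeasureTheory

variable {p s : ℕ} {T : (Fin s → ℕ) → Prop} {ℓ : ℕ}

lemma mono_mem_polySpace {a b : ℕ} {m n : Fin p → ℕ} {c : Fin s → ℕ}
    (h : a + b + ∑ j, m j + ∑ j, n j + ∑ k, c k = ℓ) (hc : T c) :
    mono a b m n c ∈ polySpace p s T ℓ :=
  Submodule.subset_span ⟨a, b, m, n, c, h, hc, rfl⟩

lemma mono_mul_mono (a b a' b' : ℕ) (m n m' n' : Fin p → ℕ) (c c' : Fin s → ℕ) :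
    mono a b m n c * mono a' b' m' n' c' =
      mono (a + a') (b + b') (m + m') (n + n') (c + c') := by
  funext w
  simp only [mono, Pi.mul_apply, Pi.add_apply, pow_add, Finset.prod_mul_distrib]
  ring

lemma conj_mono (a b : ℕ) (m n : Fin p → ℕ) (c : Fin s → ℕ) (w : W p s) :
    (starRingEnd ℂ) (mono a b m n c w) = mono a b n m c w := by
  simp only [mono, map_mul, map_prod, map_pow, Complex.conj_ofReal, Complex.conj_conj]
  ring

lemma conj_mem_polySpace {F : W p s → ℂ} (hF : F ∈ polySpace p s T ℓ) :
    (fun w => (starRingEnd ℂ) (F w)) ∈ polySpace p s T ℓ := by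
  induction hF using Submodule.span_induction with
  | mem F h =>
    obtain ⟨a, b, m, n, c, h, hc, rfl⟩ := h
    simp only [conj_mono]
    exact mono_mem_polySpace (by omega) hc
  | zero =>
    convert (polySpace p s T ℓ).zero_mem using 1
    funext w
    simp
  | add F G _ _ hF hG =>
    convert (polySpace p s T ℓ).add_mem hF hG using 1
    funext w
    simp
  | smul z F _ hF =>
    convert (polySpace p s T ℓ).smul_mem ((starRingEnd ℂ) z) hF using 1
    funext w
    simp

lemma re_mem_polySpace {F : W p s → ℂ} (hF : F ∈ polySpace p s T ℓ) :
    (fun w => ((F w).re : ℂ)) ∈ polySpace p s T ℓ := by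
  have h := (polySpace p s T ℓ).smul_mem (2⁻¹ : ℂ) ((polySpace p s T ℓ).add_mem hF
    (conj_mem_polySpace hF))
  convert h using 1
  funext w
  simp only [Pi.smul_apply, Pi.add_apply, Complex.add_conj, smul_eq_mul]
  push_cast
  ring

lemma mul_mem_polySpace {k l : ℕ} {F G : W p s → ℂ}
    (hF : F ∈ polySpace p s (fun _ => True) k) (hG : G ∈ polySpace p s (fun _ => True) l) :
    F * G ∈ polySpace p s (fun _ => True) (k + l) := by
  have h := Submodule.mul_mem_mul hF hG
  rw [polySpace, polySpace, Submodule.span_mul_span] at h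
  refine Submodule.span_mono ?_ h
  rintro _ ⟨_, ⟨a, b, m, n, c, h, -, rfl⟩, _, ⟨a', b', m', n', c', h', -, rfl⟩, rfl⟩
  refine ⟨_, _, _, _, _, ?_, trivial, mono_mul_mono ..⟩
  simp only [Pi.add_apply, Finset.sum_add_distrib]
  omega

lemma differentiable_mono (a b : ℕ) (m n : Fin p → ℕ) (c : Fin s → ℕ) :
    Differentiable ℝ (mono (p := p) (s := s) a b m n c) := by
  have h1 : Differentiable ℝ (fun w : W p s => (w.1.1 : ℂ)) :=
    Complex.ofRealCLM.differentiable.comp (by fun_prop)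
  have h2 : Differentiable ℝ (fun w : W p s => (w.2.1 : ℂ)) :=
    Complex.ofRealCLM.differentiable.comp (by fun_prop)
  have h3 (j) : Differentiable ℝ (fun w : W p s => w.1.2 j) := by fun_prop
  have h4 (j) : Differentiable ℝ (fun w : W p s => (starRingEnd ℂ) (w.1.2 j)) :=
    Complex.conjCLE.differentiable.comp (h3 j)
  have h5 (k) : Differentiable ℝ (fun w : W p s => (w.2.2 k : ℂ)) :=
    Complex.ofRealCLM.differentiable.comp (by fun_prop)
  unfold mono
  fun_prop

lemma differentiable_of_mem {F : W p s → ℂ} (hF : F ∈ polySpace p s T ℓ) :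
    Differentiable ℝ F := by
  induction hF using Submodule.span_induction with
  | mem F h =>
    obtain ⟨a, b, m, n, c, -, -, rfl⟩ := h
    exact differentiable_mono a b m n c
  | zero => exact differentiable_const 0
  | add F G _ _ hF hG => exact hF.add hG
  | smul z F _ hF => exact hF.const_smul z

lemma mono_torusAct (a b : ℕ) (m n : Fin p → ℕ) (c : Fin s → ℕ) (θ : Fin p → ℝ)
    (x : V p) (ν : ℝ) (μ : Fin s → ℝ) :
    mono a b m n c (torusAct p θ x, ν, μ) =
      Complex.exp (Complex.I * ∑ j, ((m j : ℂ) - n j) * θ j) * mono a b m n c (x, ν, μ) := by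
  have h : Complex.exp (Complex.I * ∑ j, ((m j : ℂ) - n j) * θ j) =
      (∏ j, Complex.exp (Complex.I * θ j) ^ m j) *
        ∏ j, (starRingEnd ℂ) (Complex.exp (Complex.I * θ j)) ^ n j := by
    rw [Finset.mul_sum, Complex.exp_sum, ← Finset.prod_mul_distrib]
    refine Finset.prod_congr rfl fun j _ => ?_
    rw [← Complex.exp_conj, ← Complex.exp_nat_mul, ← Complex.exp_nat_mul, ← Complex.exp_add]
    congr 1
    simp only [map_mul, Complex.conj_I, Complex.conj_ofReal]
    ring
  rw [h]
  simp only [mono, torusAct, map_mul, mul_pow, Finset.prod_mul_distrib]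
  ring

/-- Averages of characters over the torus. -/
lemma integral_torusBox_exp (k : Fin p → ℤ) :
    ∫ θ in torusBox p, Complex.exp (Complex.I * ∑ j, (k j : ℂ) * θ j) =
      if k = 0 then ((2 * Real.pi) ^ p : ℝ) else 0 := by
  have hone (i : ℤ) : ∫ t in Set.Icc 0 (2 * Real.pi), Complex.exp (Complex.I * (i * t)) =
      if i = 0 then ((2 * Real.pi : ℝ) : ℂ) else 0 := by
    split_ifs with hi
    · simp [hi, Real.pi_pos.le]
    · have hi' : Complex.I * i ≠ 0 := mul_ne_zero Complex.I_ne_zero (Int.cast_ne_zero.2 hi)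
      rw [integral_Icc_eq_integral_Ioc,
        ← intervalIntegral.integral_of_le (by positivity)]
      simp only [← mul_assoc]
      rw [integral_exp_mul_complex hi']
      have : Complex.exp (Complex.I * i * ((2 * Real.pi : ℝ) : ℂ)) = 1 :=
        Complex.exp_eq_one_iff.2 ⟨i, by push_cast; ring⟩
      rw [this]
      simp
  simp only [Finset.mul_sum, Complex.exp_sum]
  rw [torusBox, volume_pi, Measure.restrict_pi_pi]
  rw [integral_fintype_prod_eq_prod
    (f := fun (j : Fin p) (t : ℝ) => Complex.exp (Complex.I * ((k j : ℂ) * t)))]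
  simp only [hone]
  split_ifs with hk
  · simp [hk]
  · obtain ⟨j, hj⟩ := Function.ne_iff.1 hk
    exact Finset.prod_eq_zero (Finset.mem_univ j) (if_neg hj)

lemma charAvg_mono (e : Fin p → ℤ) (a b : ℕ) (m n : Fin p → ℕ) (c : Fin s → ℕ) (w : W p s) :
    charAvg e (mono a b m n c) w =
      if ∀ j, (m j : ℤ) - n j = e j then mono a b m n c (w.1, 0, w.2.2) else 0 := by
  have h (θ : Fin p → ℝ) : Complex.exp (Complex.I * ∑ j, (e j : ℂ) * θ j) *
      mono a b m n c (torusAct p (-θ) w.1, 0, w.2.2) =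
      Complex.exp (Complex.I * ∑ j, ((e j - (m j - n j) : ℤ) : ℂ) * θ j) *
        mono a b m n c (w.1, 0, w.2.2) := by
    rw [mono_torusAct, ← mul_assoc, ← Complex.exp_add, ← mul_add, ← Finset.sum_add_distrib]
    congr 4
    funext j
    simp only [Pi.neg_apply]
    push_cast
    ring
  simp only [charAvg, h]
  rw [integral_mul_const, integral_torusBox_exp (fun j => e j - (m j - n j))]
  have hiff : ((fun j => e j - ((m j : ℤ) - n j)) = 0) ↔ ∀ j, (m j : ℤ) - n j = e j := by
    rw [funext_iff]
    exact forall_congr' fun j => by simp [sub_eq_zero, eq_comm]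
  simp only [hiff]
  split_ifs
  · rw [Complex.real_smul, ← mul_assoc, ← Complex.ofReal_mul, inv_mul_cancel₀ (by positivity)]
    simp
  · simp

lemma continuous_torusAct : Continuous fun q : (Fin p → ℝ) × V p => torusAct p q.1 q.2 := by
  unfold torusAct
  fun_prop

lemma isCompact_torusBox : IsCompact (torusBox p) :=
  isCompact_univ_pi fun _ => isCompact_Icc

lemma integrable_charAvg (e : Fin p → ℤ) {F : W p s → ℂ} (hF : Continuous F) (w : W p s) :
    IntegrableOn (fun θ => Complex.exp (Complex.I * ∑ j, (e j : ℂ) * θ j) *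
      F (torusAct p (-θ) w.1, 0, w.2.2)) (torusBox p) := by
  refine ContinuousOn.integrableOn_compact isCompact_torusBox (Continuous.continuousOn ?_)
  have h : Continuous fun θ : Fin p → ℝ => torusAct p (-θ) w.1 :=
    continuous_torusAct.comp (by fun_prop : Continuous fun θ : Fin p → ℝ => (-θ, w.1))
  fun_prop

lemma charAvg_add (e : Fin p → ℤ) {F G : W p s → ℂ} (hF : Continuous F) (hG : Continuous G) :
    charAvg e (F + G) = charAvg e F + charAvg e G := by
  funext w
  simp only [charAvg, Pi.add_apply, mul_add]
  rw [integral_add (integrable_charAvg e hF w) (integrable_charAvg e hG w), smul_add]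

lemma charAvg_smul (e : Fin p → ℤ) (z : ℂ) (F : W p s → ℂ) :
    charAvg e (z • F) = z • charAvg e F := by
  funext w
  simp only [charAvg, Pi.smul_apply, smul_eq_mul, mul_left_comm _ z]
  rw [integral_const_mul, mul_smul_comm]

lemma homOp_add (ω : Fin p → ℝ) (e : Fin p → ℤ) {F G : W p s → ℂ} (hF : Differentiable ℝ F)
    (hG : Differentiable ℝ G) : homOp ω e (F + G) = homOp ω e F + homOp ω e G := by
  funext w
  simp only [homOp, fderiv_add (hF w) (hG w), Pi.add_apply, _root_.add_apply]
  ring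

lemma homOp_smul (ω : Fin p → ℝ) (e : Fin p → ℤ) (z : ℂ) {F : W p s → ℂ}
    (hF : Differentiable ℝ F) : homOp ω e (z • F) = z • homOp ω e F := by
  funext w
  simp only [homOp, fderiv_const_smul (hF w), Pi.smul_apply, _root_.smul_apply, smul_eq_mul]
  ring

lemma charAvg_zero (e : Fin p → ℤ) : charAvg e (0 : W p s → ℂ) = 0 := by
  funext w
  simp [charAvg]

lemma homOp_zero (ω : Fin p → ℝ) (e : Fin p → ℤ) : homOp ω e (0 : W p s → ℂ) = 0 := by
  funext w
  simp [homOp]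

lemma homOp_mono (ω : Fin p → ℝ) (e : Fin p → ℤ) (a b : ℕ) (m n : Fin p → ℕ) (c : Fin s → ℕ) :
    homOp ω e (mono a b m n c : W p s → ℂ) =
      (Complex.I * ∑ j, (((m j : ℤ) - n j - e j : ℤ) : ℂ) * ω j) • mono a b m n c +
        (a : ℂ) • mono (a - 1) (b + 1) m n c := by
  funext w
  have hd := (differentiable_mono a b m n c w).hasFDerivAt
  have hB : fderiv ℝ (mono a b m n c) w (Bmap p ω w.1, 0, 0) =
      (Complex.I * ∑ j, ((m j : ℂ) - n j) * ω j) * mono a b m n c w := by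
    have hcurve : HasDerivAt (fun t : ℝ => ((torusAct p (t • ω) w.1, w.2.1, w.2.2) : W p s))
        (Bmap p ω w.1, 0, 0) 0 := by
      refine HasDerivAt.prodMk (HasDerivAt.prodMk (hasDerivAt_const _ _)
        (hasDerivAt_pi.2 fun j => ?_)) (hasDerivAt_const _ _)
      have h : HasDerivAt (fun t : ℝ => Complex.I * ((t * ω j : ℝ) : ℂ))
          (Complex.I * ((1 * ω j : ℝ) : ℂ)) 0 :=
        (((hasDerivAt_id (0 : ℝ)).mul_const (ω j)).ofReal_comp).const_mul _
      simpa using (h.cexp).mul_const (w.1.2 j)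
    have h0 : ((torusAct p ((0 : ℝ) • ω) w.1, w.2.1, w.2.2) : W p s) = w := by
      simp [torusAct]
    have h1 := HasFDerivAt.comp_hasDerivAt (0 : ℝ) (h0.symm ▸ hd) hcurve
    have h2 : HasDerivAt (fun t : ℝ => mono a b m n c (torusAct p (t • ω) w.1, w.2.1, w.2.2))
        ((Complex.I * ∑ j, ((m j : ℂ) - n j) * ω j) * mono a b m n c w) 0 := by
      have h : HasDerivAt (fun t : ℝ => (t : ℂ) * (Complex.I * ∑ j, ((m j : ℂ) - n j) * ω j))
          (1 * (Complex.I * ∑ j, ((m j : ℂ) - n j) * ω j)) 0 :=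
        (Complex.ofRealCLM.hasDerivAt (x := (0 : ℝ))).mul_const _
      have h' := h.cexp.mul_const (mono a b m n c w)
      simp only [Complex.ofReal_zero, zero_mul, Complex.exp_zero, one_mul] at h'
      refine h'.congr_of_eventuallyEq (Filter.Eventually.of_forall fun t => ?_)
      simp only [mono_torusAct, Pi.smul_apply, smul_eq_mul]
      congr 2
      rw [mul_left_comm]
      congr 1
      rw [Finset.mul_sum]
      refine Finset.sum_congr rfl fun j _ => ?_
      push_cast
      ring
    rw [h0] at h1
    exact h1.unique h2
  have hX : fderiv ℝ (mono a b m n c) w (((1 : ℝ), (0 : Fin p → ℂ)), 0, 0) =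
      a * (w.1.1 : ℂ) ^ (a - 1) * ((w.2.1 : ℂ) ^ b * (∏ j, w.1.2 j ^ m j) *
        (∏ j, (starRingEnd ℂ) (w.1.2 j) ^ n j) * ∏ k, (w.2.2 k : ℂ) ^ c k) := by
    have hcurve : HasDerivAt (fun t : ℝ => (((t, w.1.2), w.2.1, w.2.2) : W p s))
        (((1 : ℝ), (0 : Fin p → ℂ)), 0, 0) w.1.1 :=
      HasDerivAt.prodMk (HasDerivAt.prodMk (hasDerivAt_id _) (hasDerivAt_const _ _))
        (hasDerivAt_const _ _)
    have h1 := HasFDerivAt.comp_hasDerivAt w.1.1 (f := fun t : ℝ =>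
      (((t, w.1.2), w.2.1, w.2.2) : W p s)) hd hcurve
    have h2 := ((Complex.ofRealCLM.hasDerivAt (x := w.1.1)).pow a).mul_const
      ((w.2.1 : ℂ) ^ b * (∏ j, w.1.2 j ^ m j) *
        (∏ j, (starRingEnd ℂ) (w.1.2 j) ^ n j) * ∏ k, (w.2.2 k : ℂ) ^ c k)
    simp only [Complex.ofRealCLM_apply, Complex.ofReal_one, mul_one] at h2
    refine h1.unique (h2.congr_of_eventuallyEq (Filter.Eventually.of_forall fun t => ?_))
    simp [mono, mul_assoc]
  simp only [homOp, hB, hX, Pi.add_apply, Pi.smul_apply, smul_eq_mul]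
  simp only [Int.cast_sub, Int.cast_natCast, sub_mul (_ - _), Finset.sum_sub_distrib]
  simp only [mono, pow_succ]
  ring

/-- A scalar function is the sum of its average and an element of the range of `homOp`. -/
lemma exists_eq_charAvg_add_homOp {ω : Fin p → ℝ}
    (hind : ∀ r : Fin p → ℚ, (∑ j, (r j : ℝ) * ω j) = 0 → ∀ j, r j = 0)
    (e : Fin p → ℤ) {F : W p s → ℂ} (hF : F ∈ polySpace p s T ℓ) :
    ∃ G ∈ polySpace p s T ℓ, F = charAvg e F + homOp ω e G := by
  induction hF using Submodule.span_induction with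
  | mem F h =>
    obtain ⟨a, b, m, n, c, h, hc, rfl⟩ := h
    by_cases hres : ∀ j, (m j : ℤ) - n j = e j
    · have hsum : (∑ j, (((m j : ℤ) - n j - e j : ℤ) : ℂ) * ω j) = 0 :=
        Finset.sum_eq_zero fun j _ => by simp [hres j]
      cases b with
      | zero =>
        refine ⟨0, Submodule.zero_mem _, ?_⟩
        funext w
        simp [homOp_zero, charAvg_mono, hres, mono]
      | succ b =>
        refine ⟨((a + 1 : ℕ) : ℂ)⁻¹ • mono (a + 1) b m n c,
          Submodule.smul_mem _ _ (mono_mem_polySpace (by omega) hc), ?_⟩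
        have h0 : ((a + 1 : ℕ) : ℂ) ≠ 0 := Nat.cast_ne_zero.2 a.succ_ne_zero
        have h1 : charAvg e (mono a (b + 1) m n c : W p s → ℂ) = 0 := by
          funext w
          simp [charAvg_mono, mono]
        rw [h1, homOp_smul _ _ _ (differentiable_mono _ _ _ _ _), homOp_mono, hsum, mul_zero, zero_smul,
          zero_add, zero_add, smul_smul, inv_mul_cancel₀ h0, one_smul, Nat.add_sub_cancel]
    · have hsum : Complex.I * (∑ j, (((m j : ℤ) - n j - e j : ℤ) : ℂ) * ω j) ≠ 0 := by
        refine mul_ne_zero Complex.I_ne_zero fun h0 => hres fun j => ?_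
        have h1 := hind (fun j => (((m j : ℤ) - n j - e j : ℤ) : ℚ)) (by
          have h2 := congrArg Complex.re h0
          rw [Complex.re_sum] at h2
          simp only [← Complex.ofReal_intCast, ← Complex.ofReal_mul, Complex.ofReal_re] at h2
          push_cast at h2 ⊢
          exact h2) j
        have h2 : (m j : ℤ) - n j - e j = 0 := by exact_mod_cast h1
        omega
      have h1 : charAvg e (mono a b m n c : W p s → ℂ) = 0 := by
        funext w
        simp [charAvg_mono, hres]
      rw [h1]
      simp only [zero_add]
      clear h1
      induction a generalizing b with
      | zero =>
        refine ⟨_, Submodule.smul_mem _ (Complex.I * (∑ j,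
          (((m j : ℤ) - n j - e j : ℤ) : ℂ) * ω j))⁻¹ (mono_mem_polySpace h hc), ?_⟩
        rw [homOp_smul _ _ _ (differentiable_mono _ _ _ _ _), homOp_mono, Nat.cast_zero, zero_smul,
          add_zero, smul_smul, inv_mul_cancel₀ hsum, one_smul]
      | succ a ih =>
        obtain ⟨G, hG, hGe⟩ := ih (b + 1) (by omega)
        refine ⟨_, Submodule.smul_mem _ (Complex.I * (∑ j,
          (((m j : ℤ) - n j - e j : ℤ) : ℂ) * ω j))⁻¹
            (Submodule.add_mem _ (mono_mem_polySpace h hc)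
              (Submodule.smul_mem _ (-((a + 1 : ℕ) : ℂ)) hG)), ?_⟩
        have hGd := differentiable_of_mem hG
        rw [homOp_smul _ _ _ ((differentiable_mono _ _ _ _ _).add (hGd.const_smul _)),
          homOp_add _ _ (differentiable_mono _ _ _ _ _) (hGd.const_smul _), homOp_smul _ _ _ hGd,
          homOp_mono, Nat.add_sub_cancel, ← hGe, add_assoc, ← add_smul, add_neg_cancel, zero_smul,
          add_zero, smul_smul, inv_mul_cancel₀ hsum, one_smul]
  | zero => exact ⟨0, Submodule.zero_mem _, by simp [charAvg_zero, homOp_zero]⟩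
  | add F F' hFm hFm' hF hF' =>
    obtain ⟨G, hG, hGe⟩ := hF
    obtain ⟨G', hG', hGe'⟩ := hF'
    refine ⟨G + G', Submodule.add_mem _ hG hG', ?_⟩
    rw [charAvg_add e (differentiable_of_mem hFm).continuous
      (differentiable_of_mem hFm').continuous,
      homOp_add _ _ (differentiable_of_mem hG) (differentiable_of_mem hG'), add_add_add_comm,
      ← hGe, ← hGe']
  | smul z F _ hF =>
    obtain ⟨G, hG, hGe⟩ := hF
    refine ⟨z • G, Submodule.smul_mem _ _ hG, ?_⟩
    rw [charAvg_smul, homOp_smul _ _ _ (differentiable_of_mem hG), ← smul_add, ← hGe]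

lemma homOp_mem (ω : Fin p → ℝ) (e : Fin p → ℤ) {F : W p s → ℂ}
    (hF : F ∈ polySpace p s T ℓ) : homOp ω e F ∈ polySpace p s T ℓ := by
  induction hF using Submodule.span_induction with
  | mem F h =>
    obtain ⟨a, b, m, n, c, h, hc, rfl⟩ := h
    rw [homOp_mono]
    refine Submodule.add_mem _ (Submodule.smul_mem _ _ (mono_mem_polySpace h hc)) ?_
    cases a with
    | zero => simp
    | succ a => exact Submodule.smul_mem _ _ (mono_mem_polySpace (by omega) hc)
  | zero => simp [homOp_zero]
  | add F G hFm hGm hF hG =>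
    rw [homOp_add _ _ (differentiable_of_mem hFm) (differentiable_of_mem hGm)]
    exact Submodule.add_mem _ hF hG
  | smul z F hFm hF =>
    rw [homOp_smul _ _ _ (differentiable_of_mem hFm)]
    exact Submodule.smul_mem _ _ hF

lemma charAvg_homOp (ω : Fin p → ℝ) (e : Fin p → ℤ) {F : W p s → ℂ}
    (hF : F ∈ polySpace p s T ℓ) : charAvg e (homOp ω e F) = 0 := by
  induction hF using Submodule.span_induction with
  | mem F h =>
    obtain ⟨a, b, m, n, c, h, hc, rfl⟩ := h
    rw [homOp_mono, charAvg_add _ ((differentiable_mono _ _ _ _ _).continuous.const_smul _)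
      ((differentiable_mono _ _ _ _ _).continuous.const_smul _), charAvg_smul, charAvg_smul]
    funext w
    simp only [Pi.add_apply, Pi.smul_apply, charAvg_mono, Pi.zero_apply]
    split_ifs with hres
    · rw [Finset.sum_eq_zero fun j _ => by simp [hres j]]
      simp [mono]
    · simp
  | zero => simp [homOp_zero, charAvg_zero]
  | add F G hFm hGm hF hG =>
    rw [homOp_add _ _ (differentiable_of_mem hFm) (differentiable_of_mem hGm),
      charAvg_add _ (differentiable_of_mem (homOp_mem ω e hFm)).continuous
        (differentiable_of_mem (homOp_mem ω e hGm)).continuous, hF, hG, add_zero]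
  | smul z F hFm hF =>
    rw [homOp_smul _ _ _ (differentiable_of_mem hFm), charAvg_smul, hF, smul_zero]

lemma charAvg_mem (e : Fin p → ℤ) {F : W p s → ℂ} (hF : F ∈ polySpace p s T ℓ) :
    charAvg e F ∈ polySpace p s T ℓ := by
  induction hF using Submodule.span_induction with
  | mem F h =>
    obtain ⟨a, b, m, n, c, h, hc, rfl⟩ := h
    by_cases hb : (∀ j, (m j : ℤ) - n j = e j) ∧ b = 0
    · convert mono_mem_polySpace h hc using 1
      funext w
      simp [charAvg_mono, mono, hb.1, hb.2]
    · convert (polySpace p s T ℓ).zero_mem using 1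
      funext w
      rw [charAvg_mono]
      split_ifs with hres
      · simp [mono, show b ≠ 0 from fun h => hb ⟨hres, h⟩]
      · rfl
  | zero => simp [charAvg_zero]
  | add F G hFm hGm hF hG =>
    rw [charAvg_add _ (differentiable_of_mem hFm).continuous
      (differentiable_of_mem hGm).continuous]
    exact Submodule.add_mem _ hF hG
  | smul z F hFm hF =>
    rw [charAvg_smul]
    exact Submodule.smul_mem _ _ hF

lemma charAvg_torusAct (e : Fin p → ℤ) {F : W p s → ℂ} (hF : F ∈ polySpace p s T ℓ)
    (θ : Fin p → ℝ) (x : V p) (ν : ℝ) (μ : Fin s → ℝ) :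
    charAvg e F (torusAct p θ x, ν, μ) =
      Complex.exp (Complex.I * ∑ j, (e j : ℂ) * θ j) * charAvg e F (x, ν, μ) := by
  induction hF using Submodule.span_induction with
  | mem F h =>
    obtain ⟨a, b, m, n, c, h, hc, rfl⟩ := h
    simp only [charAvg_mono]
    split_ifs with hres
    · rw [mono_torusAct]
      simp [← hres]
    · simp
  | zero => simp [charAvg_zero]
  | add F G hFm hGm hF hG =>
    rw [charAvg_add _ (differentiable_of_mem hFm).continuous
      (differentiable_of_mem hGm).continuous, Pi.add_apply, Pi.add_apply, hF, hG, mul_add]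
  | smul z F hFm hF =>
    rw [charAvg_smul, Pi.smul_apply, Pi.smul_apply, hF, smul_eq_mul, smul_eq_mul, mul_left_comm]

lemma polySpace_mono {T' : (Fin s → ℕ) → Prop} (h : ∀ c, T c → T' c) :
    polySpace p s T ℓ ≤ polySpace p s T' ℓ := by
  refine Submodule.span_mono ?_
  rintro _ ⟨a, b, m, n, c, hd, hc, rfl⟩
  exact ⟨a, b, m, n, c, hd, h c hc, rfl⟩

lemma apply_zero_eq_of_mem {F : W p s → ℂ} (hF : F ∈ polySpace p s (fun c => c = 0) ℓ)
    (x : V p) (ν : ℝ) (μ : Fin s → ℝ) : F (x, ν, μ) = F (x, ν, 0) := by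
  induction hF using Submodule.span_induction with
  | mem F h =>
    obtain ⟨a, b, m, n, c, h, rfl, rfl⟩ := h
    simp [mono]
  | zero => rfl
  | add F G _ _ hF hG => simp [hF, hG]
  | smul z F _ hF => simp [hF]

lemma apply_zero_eq_zero_of_mem {F : W p s → ℂ}
    (hF : F ∈ polySpace p s (fun c => c ≠ 0) ℓ) (x : V p) (ν : ℝ) : F (x, ν, 0) = 0 := by
  induction hF using Submodule.span_induction with
  | mem F h =>
    obtain ⟨a, b, m, n, c, h, hc, rfl⟩ := h
    obtain ⟨k, hk⟩ := Function.ne_iff.1 hc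
    exact mul_eq_zero_of_right _ (Finset.prod_eq_zero (Finset.mem_univ k)
      (by simpa using hk))
  | zero => rfl
  | add F G _ _ hF hG => simp [hF, hG]
  | smul z F _ hF => simp [hF]

lemma exists_add_of_mem {F : W p s → ℂ} (hF : F ∈ polySpace p s (fun _ => True) ℓ) :
    ∃ G ∈ polySpace p s (fun c => c = 0) ℓ, ∃ H ∈ polySpace p s (fun c => c ≠ 0) ℓ,
      F = G + H := by
  refine Submodule.mem_sup.1 ?_ |>.imp fun G hG => ⟨hG.1, hG.2.imp fun H hH => ⟨hH.1, hH.2.symm⟩⟩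
  refine Submodule.span_le.2 ?_ hF
  rintro _ ⟨a, b, m, n, c, hd, -, rfl⟩
  by_cases hc : c = 0
  · exact Submodule.mem_sup_left (mono_mem_polySpace hd hc)
  · exact Submodule.mem_sup_right (mono_mem_polySpace hd hc)

lemma mem_polySpace_eq_zero_iff {F : W p s → ℂ} :
    F ∈ polySpace p s (fun c => c = 0) ℓ ↔
      F ∈ polySpace p s (fun _ => True) ℓ ∧ ∀ x ν μ, F (x, ν, μ) = F (x, ν, 0) := by
  refine ⟨fun h => ⟨polySpace_mono (fun _ _ => trivial) h, apply_zero_eq_of_mem h⟩, ?_⟩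
  rintro ⟨hF, h⟩
  obtain ⟨G, hG, H, hH, rfl⟩ := exists_add_of_mem hF
  have : G + H = G := by
    funext ⟨x, ν, μ⟩
    rw [h, Pi.add_apply, apply_zero_eq_zero_of_mem hH, add_zero, ← apply_zero_eq_of_mem hG]
  rwa [this]

lemma mem_polySpace_ne_zero_iff {F : W p s → ℂ} :
    F ∈ polySpace p s (fun c => c ≠ 0) ℓ ↔
      F ∈ polySpace p s (fun _ => True) ℓ ∧ ∀ x ν, F (x, ν, 0) = 0 := by
  refine ⟨fun h => ⟨polySpace_mono (fun _ _ => trivial) h, apply_zero_eq_zero_of_mem h⟩, ?_⟩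
  rintro ⟨hF, h⟩
  obtain ⟨G, hG, H, hH, rfl⟩ := exists_add_of_mem hF
  have : G + H = H := by
    funext ⟨x, ν, μ⟩
    have h0 := h x ν
    rw [Pi.add_apply, apply_zero_eq_zero_of_mem hH, add_zero] at h0
    rw [Pi.add_apply, apply_zero_eq_of_mem hG, h0, zero_add]
  rwa [this]

lemma prod_pow_mem_of_mul_mem {ι R : Type*} [CommMonoid R] {M : ℕ → Set R} (h1 : 1 ∈ M 0)
    (hmul : ∀ k l F G, F ∈ M k → G ∈ M l → F * G ∈ M (k + l)) {F : ι → R}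
    (hF : ∀ i, F i ∈ M 1) (t : Finset ι) (d : ι → ℕ) :
    ∏ i ∈ t, F i ^ d i ∈ M (∑ i ∈ t, d i) := by
  classical
  have hpow (i : ι) (k : ℕ) : F i ^ k ∈ M k := by
    induction k with
    | zero => simpa using h1
    | succ k ih =>
      rw [pow_succ]
      exact hmul _ _ _ _ ih (hF i)
  induction t using Finset.induction_on with
  | empty => simpa using h1
  | insert i t hi ih =>
    rw [Finset.prod_insert hi, Finset.sum_insert hi]
    exact hmul _ _ _ _ (hpow i _) ih

lemma one_mem_polySpace : (1 : W p s → ℂ) ∈ polySpace p s (fun _ => True) 0 := by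
  convert mono_mem_polySpace (p := p) (s := s) (T := fun _ => True) (ℓ := 0) (a := 0) (b := 0)
    (m := 0) (n := 0) (c := 0) (by simp) trivial using 1
  funext w
  simp [mono]

lemma coord_mem_polySpace (j : Fin p) :
    (fun w : W p s => w.1.2 j) ∈ polySpace p s (fun _ => True) 1 := by
  convert mono_mem_polySpace (p := p) (s := s) (T := fun _ => True) (ℓ := 1) (a := 0) (b := 0)
    (m := Pi.single j 1) (n := 0) (c := 0) (by simp) trivial using 1
  funext w
  simp [mono, Pi.single_apply, pow_ite]

lemma coordsW_mem_polySpace (v : HVar p s) :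
    (fun w : W p s => (coordsW w v : ℂ)) ∈ polySpace p s (fun _ => True) 1 := by
  rcases v with (_ | ⟨j, b⟩) | _ | k
  · convert mono_mem_polySpace (p := p) (s := s) (T := fun _ => True) (ℓ := 1) (a := 1) (b := 0)
      (m := 0) (n := 0) (c := 0) (by simp) trivial using 1
    funext w
    simp [mono, coordsW]
  · cases b
    · convert re_mem_polySpace (Submodule.smul_mem _ (-Complex.I) (coord_mem_polySpace j)) using 3
      simp [coordsW]
    · exact re_mem_polySpace (coord_mem_polySpace j)
  · convert mono_mem_polySpace (p := p) (s := s) (T := fun _ => True) (ℓ := 1) (a := 0) (b := 1)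
      (m := 0) (n := 0) (c := 0) (by simp) trivial using 1
    funext w
    simp [mono, coordsW]
  · convert mono_mem_polySpace (p := p) (s := s) (T := fun _ => True) (ℓ := 1) (a := 0) (b := 0)
      (m := 0) (n := 0) (c := Pi.single k 1) (by simp) trivial using 1
    funext w
    simp [mono, coordsW, Pi.single_apply, pow_ite]

lemma IsHomogScalar.ofReal_mem_polySpace {f : W p s → ℝ} (hf : IsHomogScalar p s ℓ f) :
    (fun w => (f w : ℂ)) ∈ polySpace p s (fun _ => True) ℓ := by
  obtain ⟨P, hP, hfP⟩ := hf
  have h : (fun w => (f w : ℂ)) = ∑ d ∈ P.support, ((P.coeff d : ℝ) : ℂ) •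
      ∏ v, (fun w : W p s => (coordsW w v : ℂ)) ^ d v := by
    funext w
    simp [hfP, MvPolynomial.eval_eq']
  rw [h]
  refine Submodule.sum_mem _ fun d hd => Submodule.smul_mem _ _ ?_
  have hdeg : ∑ v, d v = ℓ := by
    rw [← Finsupp.degree_eq_sum, Finsupp.degree_eq_weight_one]
    exact hP (MvPolynomial.mem_support_iff.1 hd)
  rw [← hdeg]
  exact prod_pow_mem_of_mul_mem (M := fun k => (polySpace p s (fun _ => True) k : Set (W p s → ℂ)))
    (F := fun (v : HVar p s) (w : W p s) => (coordsW w v : ℂ)) one_mem_polySpace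
    (fun _ _ _ _ => mul_mem_polySpace) coordsW_mem_polySpace _ _

lemma IsHomogScalar.add {f g : W p s → ℝ} (hf : IsHomogScalar p s ℓ f)
    (hg : IsHomogScalar p s ℓ g) : IsHomogScalar p s ℓ fun w => f w + g w := by
  obtain ⟨P, hP, hfP⟩ := hf
  obtain ⟨Q, hQ, hgQ⟩ := hg
  exact ⟨P + Q, hP.add hQ, fun w => by simp [hfP, hgQ]⟩

lemma IsHomogScalar.mul {k l : ℕ} {f g : W p s → ℝ} (hf : IsHomogScalar p s k f)
    (hg : IsHomogScalar p s l g) : IsHomogScalar p s (k + l) fun w => f w * g w := by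
  obtain ⟨P, hP, hfP⟩ := hf
  obtain ⟨Q, hQ, hgQ⟩ := hg
  exact ⟨P * Q, hP.mul hQ, fun w => by simp [hfP, hgQ]⟩

lemma isHomogScalar_const (r : ℝ) : IsHomogScalar p s 0 fun _ => r :=
  ⟨MvPolynomial.C r, MvPolynomial.isHomogeneous_C _ _, fun w => by simp⟩

lemma IsHomogScalar.const_mul (r : ℝ) {f : W p s → ℝ} (hf : IsHomogScalar p s ℓ f) :
    IsHomogScalar p s ℓ fun w => r * f w := by
  simpa using (isHomogScalar_const r).mul hf

lemma IsHomogScalar.sub {f g : W p s → ℝ} (hf : IsHomogScalar p s ℓ f)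
    (hg : IsHomogScalar p s ℓ g) : IsHomogScalar p s ℓ fun w => f w - g w := by
  simpa [sub_eq_add_neg] using hf.add (hg.const_mul (-1))

lemma isHomogScalar_zero : IsHomogScalar p s ℓ fun _ => 0 :=
  ⟨0, MvPolynomial.isHomogeneous_zero _ _ _, fun w => by simp⟩

lemma isHomogScalar_coordsW (v : HVar p s) : IsHomogScalar p s 1 fun w => coordsW w v :=
  ⟨MvPolynomial.X v, MvPolynomial.isHomogeneous_X _ _, fun w => by simp⟩

/-- Complex functions with homogeneous real and imaginary parts. -/
def reImHomog (p s ℓ : ℕ) : Set (W p s → ℂ) :=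
  {F | IsHomogScalar p s ℓ (fun w => (F w).re) ∧ IsHomogScalar p s ℓ fun w => (F w).im}

lemma one_mem_reImHomog : (1 : W p s → ℂ) ∈ reImHomog p s 0 :=
  ⟨by simpa using isHomogScalar_const 1, by simpa using isHomogScalar_const 0⟩

lemma mul_mem_reImHomog (k l : ℕ) (F G : W p s → ℂ) (hF : F ∈ reImHomog p s k)
    (hG : G ∈ reImHomog p s l) : F * G ∈ reImHomog p s (k + l) := by
  refine ⟨?_, ?_⟩
  · simpa using (hF.1.mul hG.1).sub (hF.2.mul hG.2)
  · simpa using (hF.1.mul hG.2).add (hF.2.mul hG.1)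

lemma ofReal_mem_reImHomog {f : W p s → ℝ} (hf : IsHomogScalar p s ℓ f) :
    (fun w => (f w : ℂ)) ∈ reImHomog p s ℓ :=
  ⟨by simpa using hf, by simpa using isHomogScalar_zero⟩

lemma mono_mem_reImHomog (a b : ℕ) (m n : Fin p → ℕ) (c : Fin s → ℕ) :
    mono a b m n c ∈ reImHomog p s (a + b + ∑ j, m j + ∑ j, n j + ∑ k, c k) := by
  have key {ι : Type} [Fintype ι] (F : ι → W p s → ℂ) (hF : ∀ i, F i ∈ reImHomog p s 1)
      (d : ι → ℕ) : ∏ i, F i ^ d i ∈ reImHomog p s (∑ i, d i) :=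
    prod_pow_mem_of_mul_mem one_mem_reImHomog mul_mem_reImHomog hF _ d
  have hz (j : Fin p) : (fun w : W p s => w.1.2 j) ∈ reImHomog p s 1 :=
    ⟨isHomogScalar_coordsW (.inl (.inr (j, true))), isHomogScalar_coordsW (.inl (.inr (j, false)))⟩
  have hz' (j : Fin p) : (fun w : W p s => (starRingEnd ℂ) (w.1.2 j)) ∈ reImHomog p s 1 :=
    ⟨by simpa using (hz j).1, by simpa using (hz j).2.const_mul (-1)⟩
  have h1 := key (fun _ : Unit => fun w : W p s => (w.1.1 : ℂ))
    (fun _ => ofReal_mem_reImHomog (isHomogScalar_coordsW (.inl (.inl ())))) (fun _ => a)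
  have h2 := key (fun _ : Unit => fun w : W p s => (w.2.1 : ℂ))
    (fun _ => ofReal_mem_reImHomog (isHomogScalar_coordsW (.inr (.inl ())))) (fun _ => b)
  have h5 := key (fun k : Fin s => fun w : W p s => (w.2.2 k : ℂ))
    (fun k => ofReal_mem_reImHomog (isHomogScalar_coordsW (.inr (.inr k)))) c
  have h := mul_mem_reImHomog _ _ _ _ (mul_mem_reImHomog _ _ _ _ (mul_mem_reImHomog _ _ _ _
    (mul_mem_reImHomog _ _ _ _ h1 h2) (key _ hz m)) (key _ hz' n)) h5
  simp only [Finset.univ_unique, Finset.prod_singleton, Finset.sum_singleton] at h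
  convert h using 1
  funext w
  simp [mono]

lemma mem_reImHomog_of_mem {F : W p s → ℂ} (hF : F ∈ polySpace p s T ℓ) :
    F ∈ reImHomog p s ℓ := by
  induction hF using Submodule.span_induction with
  | mem F h =>
    obtain ⟨a, b, m, n, c, rfl, -, rfl⟩ := h
    exact mono_mem_reImHomog a b m n c
  | zero => exact ⟨by simpa using isHomogScalar_zero, by simpa using isHomogScalar_zero⟩
  | add F G _ _ hF hG => exact ⟨by simpa using hF.1.add hG.1, by simpa using hF.2.add hG.2⟩
  | smul z F _ hF =>
    exact ⟨by simpa using (hF.1.const_mul z.re).sub (hF.2.const_mul z.im),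
      by simpa using (hF.2.const_mul z.re).add (hF.1.const_mul z.im)⟩

/-- Maps all of whose components lie in `polySpace p s T ℓ`. -/
def MemPoly (p s : ℕ) (T : (Fin s → ℕ) → Prop) (ℓ : ℕ) (f : W p s → V p) : Prop :=
  (fun w => ((f w).1 : ℂ)) ∈ polySpace p s T ℓ ∧ ∀ j, (fun w => (f w).2 j) ∈ polySpace p s T ℓ

lemma memPoly_true_iff {f : W p s → V p} : MemPoly p s (fun _ => True) ℓ f ↔ MemH p s ℓ f := by
  refine ⟨fun h => ⟨by simpa using (mem_reImHomog_of_mem h.1).1,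
    fun j => mem_reImHomog_of_mem (h.2 j)⟩, fun h => ⟨h.1.ofReal_mem_polySpace, fun j => ?_⟩⟩
  convert Submodule.add_mem _ (h.2 j).1.ofReal_mem_polySpace
    (Submodule.smul_mem _ Complex.I (h.2 j).2.ofReal_mem_polySpace) using 1
  funext w
  simp only [Pi.add_apply, Pi.smul_apply, smul_eq_mul, mul_comm Complex.I, Complex.re_add_im]

lemma memPoly_eq_zero_iff {f : W p s → V p} :
    MemPoly p s (fun c => c = 0) ℓ f ↔ MemH p s ℓ f ∧ MuIndep p s f := by
  rw [← memPoly_true_iff]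
  simp only [MemPoly, mem_polySpace_eq_zero_iff]
  constructor
  · rintro ⟨⟨h1, h1'⟩, h2⟩
    refine ⟨⟨h1, fun j => (h2 j).1⟩, ?_⟩
    have h (x ν μ) : f (x, ν, μ) = f (x, ν, 0) :=
      Prod.ext (by simpa using h1' x ν μ) (funext fun j => (h2 j).2 x ν μ)
    intro x ν μ μ'
    rw [h x ν μ, h x ν μ']
  · rintro ⟨⟨h1, h2⟩, h⟩
    exact ⟨⟨h1, fun x ν μ => by rw [h x ν μ 0]⟩, fun j => ⟨h2 j, fun x ν μ => by rw [h x ν μ 0]⟩⟩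

lemma memPoly_ne_zero_iff {f : W p s → V p} :
    MemPoly p s (fun c => c ≠ 0) ℓ f ↔ MemH p s ℓ f ∧ VanishMu p s f := by
  rw [← memPoly_true_iff]
  simp only [MemPoly, mem_polySpace_ne_zero_iff]
  constructor
  · rintro ⟨⟨h1, h1'⟩, h2⟩
    exact ⟨⟨h1, fun j => (h2 j).1⟩, fun x ν =>
      Prod.ext (by simpa using h1' x ν) (funext fun j => (h2 j).2 x ν)⟩
  · rintro ⟨⟨h1, h2⟩, h⟩
    exact ⟨⟨h1, fun x ν => by simp [h x ν]⟩, fun j => ⟨h2 j, fun x ν => by simp [h x ν]⟩⟩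

lemma MemPoly.differentiable {f : W p s → V p} (hf : MemPoly p s T ℓ f) :
    Differentiable ℝ f := by
  have h1 : Differentiable ℝ fun w => (f w).1 :=
    Complex.reCLM.differentiable.comp (differentiable_of_mem hf.1)
  have h2 : Differentiable ℝ fun w => (f w).2 :=
    differentiable_pi.2 fun j => differentiable_of_mem (hf.2 j)
  exact h1.prodMk h2

lemma integrable_Aop {f : W p s → V p} (hf : Continuous f) (w : W p s) :
    IntegrableOn (fun θ => torusAct p θ (f (torusAct p (-θ) w.1, 0, w.2.2))) (torusBox p) := by
  refine ContinuousOn.integrableOn_compact isCompact_torusBox (Continuous.continuousOn ?_)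
  have h : Continuous fun θ : Fin p → ℝ => torusAct p (-θ) w.1 :=
    continuous_torusAct.comp (by fun_prop : Continuous fun θ : Fin p → ℝ => (-θ, w.1))
  exact continuous_torusAct.comp
    (by fun_prop : Continuous fun θ : Fin p → ℝ => (θ, f (torusAct p (-θ) w.1, 0, w.2.2)))

lemma Aop_fst {f : W p s → V p} (hf : Continuous f) (w : W p s) :
    ((Aop p s f w).1 : ℂ) = charAvg 0 (fun w => ((f w).1 : ℂ)) w := by
  have h := (Complex.ofRealCLM.comp (ContinuousLinearMap.fst ℝ ℝ (Fin p → ℂ))).integral_comp_comm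
    (integrable_Aop hf w)
  simp only [Aop, charAvg, Prod.smul_fst, smul_eq_mul, Complex.ofReal_mul, Complex.real_smul]
  congr 1
  refine h.symm.trans ?_
  simp [torusAct]

lemma Aop_snd {f : W p s → V p} (hf : Continuous f) (w : W p s) (j : Fin p) :
    (Aop p s f w).2 j = charAvg (Pi.single j 1) (fun w => (f w).2 j) w := by
  have h := ((ContinuousLinearMap.proj (R := ℝ) (φ := fun _ : Fin p => ℂ) j).comp
    (ContinuousLinearMap.snd ℝ ℝ (Fin p → ℂ))).integral_comp_comm (integrable_Aop hf w)
  simp only [Aop, charAvg, Prod.smul_snd, Pi.smul_apply]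
  congr 1
  refine h.symm.trans ?_
  simp [torusAct, Pi.single_apply]

lemma Lop_fst (ω : Fin p → ℝ) {f : W p s → V p} (hf : Differentiable ℝ f) (w : W p s) :
    ((Lop p s ω f w).1 : ℂ) = homOp ω 0 (fun w => ((f w).1 : ℂ)) w := by
  have h : HasFDerivAt (fun w => ((f w).1 : ℂ)) ((Complex.ofRealCLM.comp
      (ContinuousLinearMap.fst ℝ ℝ (Fin p → ℂ))).comp (fderiv ℝ f w)) w :=
    (Complex.ofRealCLM.comp (ContinuousLinearMap.fst ℝ ℝ (Fin p → ℂ))).hasFDerivAt.comp w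
      (hf w).hasFDerivAt
  simp [Lop, homOp, h.fderiv, Bmap]

lemma Lop_snd (ω : Fin p → ℝ) {f : W p s → V p} (hf : Differentiable ℝ f) (w : W p s)
    (j : Fin p) :
    (Lop p s ω f w).2 j = homOp ω (Pi.single j 1) (fun w => (f w).2 j) w := by
  have h : HasFDerivAt (fun w => (f w).2 j)
      (((ContinuousLinearMap.proj (R := ℝ) (φ := fun _ : Fin p => ℂ) j).comp
      (ContinuousLinearMap.snd ℝ ℝ (Fin p → ℂ))).comp (fderiv ℝ f w)) w :=
    ((ContinuousLinearMap.proj (R := ℝ) (φ := fun _ : Fin p => ℂ) j).comp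
      (ContinuousLinearMap.snd ℝ ℝ (Fin p → ℂ))).hasFDerivAt.comp w (hf w).hasFDerivAt
  simp [Lop, homOp, h.fderiv, Bmap, Pi.single_apply]

lemma V.ext_ofReal {x y : V p} (h1 : (x.1 : ℂ) = y.1) (h2 : ∀ j, x.2 j = y.2 j) : x = y :=
  Prod.ext (Complex.ofReal_injective h1) (funext h2)

lemma MemPoly.Aop {f : W p s → V p} (hf : MemPoly p s T ℓ f) :
    MemPoly p s T ℓ (Aop p s f) := by
  have hc := hf.differentiable.continuous
  refine ⟨?_, fun j => ?_⟩
  · simpa only [Aop_fst hc] using charAvg_mem 0 hf.1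
  · simpa only [Aop_snd hc] using charAvg_mem _ (hf.2 j)

lemma MemPoly.Lop (ω : Fin p → ℝ) {f : W p s → V p} (hf : MemPoly p s T ℓ f) :
    MemPoly p s T ℓ (Lop p s ω f) := by
  refine ⟨?_, fun j => ?_⟩
  · simpa only [Lop_fst ω hf.differentiable] using homOp_mem ω 0 hf.1
  · simpa only [Lop_snd ω hf.differentiable] using homOp_mem ω _ (hf.2 j)

lemma nuIndep_Aop (f : W p s → V p) : NuIndep p s (Aop p s f) := fun _ _ _ _ => rfl

lemma MemPoly.equivar_Aop {f : W p s → V p} (hf : MemPoly p s T ℓ f) :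
    Equivar p s (_root_.Aop p s f) := by
  have hc := hf.differentiable.continuous
  intro θ x ν μ
  refine V.ext_ofReal ?_ fun j => ?_
  · rw [Aop_fst hc, charAvg_torusAct _ hf.1]
    simp [torusAct, Aop_fst hc]
  · rw [Aop_snd hc, charAvg_torusAct _ (hf.2 j)]
    simp [torusAct, Aop_snd hc, Pi.single_apply]

lemma Aop_eq_self {g : W p s → V p} (hν : NuIndep p s g) (he : Equivar p s g) :
    Aop p s g = g := by
  funext ⟨x, ν, μ⟩
  have h (θ : Fin p → ℝ) : torusAct p θ (g (torusAct p (-θ) x, 0, μ)) = g (x, ν, μ) := by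
    rw [← he, hν x ν 0 μ]
    congr 2
    ext j
    · rfl
    · simp [torusAct, ← mul_assoc, ← Complex.exp_add]
  have hvol : volume.real (torusBox p) = (2 * Real.pi) ^ p := by
    rw [torusBox, measureReal_def, volume_pi_pi]
    simp [Real.pi_pos.le]
  simp only [Aop, h]
  rw [setIntegral_const, hvol, smul_smul, inv_mul_cancel₀ (by positivity), one_smul]

lemma MemPoly.Aop_Lop (ω : Fin p → ℝ) {f : W p s → V p} (hf : MemPoly p s T ℓ f) :
    _root_.Aop p s (_root_.Lop p s ω f) = fun _ => 0 := by
  have hd := hf.differentiable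
  have hc := (hf.Lop ω).differentiable.continuous
  funext w
  refine V.ext_ofReal ?_ fun j => ?_
  · simp only [Aop_fst hc, Lop_fst ω hd]
    exact congrFun (charAvg_homOp ω 0 hf.1) w
  · simp only [Aop_snd hc, Lop_snd ω hd]
    exact congrFun (charAvg_homOp ω _ (hf.2 j)) w

lemma Aop_add {f g : W p s → V p} (hf : Continuous f) (hg : Continuous g) :
    Aop p s (fun w => f w + g w) = fun w => Aop p s f w + Aop p s g w := by
  have hfg : Continuous fun w => f w + g w := hf.add hg
  funext w
  refine V.ext_ofReal ?_ fun j => ?_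
  · have h := congrFun (charAvg_add 0 (F := fun w => ((f w).1 : ℂ)) (G := fun w => ((g w).1 : ℂ))
      (by fun_prop) (by fun_prop)) w
    rw [Aop_fst hfg, Prod.fst_add, Complex.ofReal_add, Aop_fst hf, Aop_fst hg]
    simpa [Pi.add_def] using h
  · have h := congrFun (charAvg_add (Pi.single j 1) (F := fun w => (f w).2 j)
      (G := fun w => (g w).2 j) (by fun_prop) (by fun_prop)) w
    rw [Aop_snd hfg, Prod.snd_add, Pi.add_apply, Aop_snd hf, Aop_snd hg]
    simpa [Pi.add_def] using h

lemma homOp_ofReal_re (ω : Fin p → ℝ) {F : W p s → ℂ} (hF : Differentiable ℝ F) (w : W p s) :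
    homOp ω 0 (fun w => ((F w).re : ℂ)) w = ((homOp ω 0 F w).re : ℂ) := by
  have h : HasFDerivAt (fun w => ((F w).re : ℂ))
      ((Complex.ofRealCLM.comp Complex.reCLM).comp (fderiv ℝ F w)) w :=
    (Complex.ofRealCLM.comp Complex.reCLM).hasFDerivAt.comp w (hF w).hasFDerivAt
  simp [homOp, h.fderiv]

lemma MemPoly.exists_eq_Aop_add_Lop {ω : Fin p → ℝ}
    (hind : ∀ r : Fin p → ℚ, (∑ j, (r j : ℝ) * ω j) = 0 → ∀ j, r j = 0)
    {f : W p s → V p} (hf : MemPoly p s T ℓ f) :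
    ∃ h, MemPoly p s T ℓ h ∧ f = fun w => _root_.Aop p s f w + _root_.Lop p s ω h w := by
  have hc := hf.differentiable.continuous
  obtain ⟨G, hG, hGe⟩ := exists_eq_charAvg_add_homOp hind 0 hf.1
  choose H hH hHe using fun j => exists_eq_charAvg_add_homOp hind (Pi.single j 1) (hf.2 j)
  have hmem : MemPoly p s T ℓ fun w => ((G w).re, fun j => H j w) :=
    ⟨re_mem_polySpace hG, hH⟩
  have hd := hmem.differentiable
  refine ⟨_, hmem, ?_⟩
  funext w
  refine V.ext_ofReal ?_ fun j => ?_
  · have h := congrFun hGe w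
    rw [Prod.fst_add, Complex.ofReal_add, Lop_fst ω hd,
      homOp_ofReal_re ω (differentiable_of_mem hG)]
    rw [Pi.add_apply, ← Aop_fst hc] at h
    have h' := congrArg Complex.re h
    simp only [Complex.add_re, Complex.ofReal_re] at h'
    rw [h', Complex.ofReal_add]
  · rw [Prod.snd_add, Pi.add_apply, Lop_snd ω hd, Aop_snd hc]
    exact congrFun (hHe j) w

end Scalar

/-- The averaging operator restricted to a class of maps given by `MemPoly`: it is a projection
onto the equivariant `ν`-independent maps along the range of the homological operator. -/
lemma averaging_projection_and_decomposition {p s ℓ : ℕ} {T : (Fin s → ℕ) → Prop}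
    {ω : Fin p → ℝ} (hind : ∀ r : Fin p → ℚ, (∑ j, (r j : ℝ) * ω j) = 0 → ∀ j, r j = 0)
    {M Q : (W p s → V p) → Prop} (hM : ∀ f, MemPoly p s T ℓ f ↔ M f ∧ Q f) :
    (∀ f : W p s → V p, M f → Q f → Aop p s (Aop p s f) = Aop p s f) ∧
    ({g : W p s → V p | ∃ f, (M f ∧ Q f) ∧ g = Aop p s f} =
      {g : W p s → V p | (M g ∧ NuIndep p s g ∧ Equivar p s g) ∧ Q g}) ∧
    ({f : W p s → V p | (M f ∧ Q f) ∧ Aop p s f = fun _ => 0} =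
      {f : W p s → V p | ∃ g, (M g ∧ Q g) ∧ f = Lop p s ω g}) ∧
    (∀ f : W p s → V p, M f → Q f →
      ∃! gk : (W p s → V p) × (W p s → V p),
        ((M gk.1 ∧ NuIndep p s gk.1 ∧ Equivar p s gk.1) ∧ Q gk.1) ∧
        (∃ h, (M h ∧ Q h) ∧ gk.2 = Lop p s ω h) ∧ f = fun w => gk.1 w + gk.2 w) := by
  have hproj {f : W p s → V p} (hf : MemPoly p s T ℓ f) : Aop p s (Aop p s f) = Aop p s f :=
    Aop_eq_self (nuIndep_Aop f) hf.equivar_Aop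
  have hrange {f : W p s → V p} (hf : MemPoly p s T ℓ f) :
      (M (Aop p s f) ∧ NuIndep p s (Aop p s f) ∧ Equivar p s (Aop p s f)) ∧ Q (Aop p s f) :=
    have h := (hM _).1 hf.Aop
    ⟨⟨h.1, nuIndep_Aop f, hf.equivar_Aop⟩, h.2⟩
  refine ⟨fun f h1 h2 => hproj ((hM f).2 ⟨h1, h2⟩), ?_, ?_, ?_⟩
  · ext g
    constructor
    · rintro ⟨f, hf, rfl⟩
      exact hrange ((hM f).2 hf)
    · rintro ⟨⟨hg, hν, he⟩, hQ⟩
      exact ⟨g, ⟨hg, hQ⟩, (Aop_eq_self hν he).symm⟩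
  · ext f
    constructor
    · rintro ⟨hf, h0⟩
      obtain ⟨h, hh, hfe⟩ := ((hM f).2 hf).exists_eq_Aop_add_Lop hind
      refine ⟨h, (hM h).1 hh, ?_⟩
      rw [h0] at hfe
      simpa using hfe
    · rintro ⟨g, hg, rfl⟩
      have hg' := (hM g).2 hg
      exact ⟨(hM _).1 (hg'.Lop ω), hg'.Aop_Lop ω⟩
  · intro f hfM hfQ
    have hf := (hM f).2 ⟨hfM, hfQ⟩
    obtain ⟨h, hh, hfe⟩ := hf.exists_eq_Aop_add_Lop hind
    refine ⟨(Aop p s f, Lop p s ω h), ⟨hrange hf, ⟨h, (hM h).1 hh, rfl⟩, hfe⟩, ?_⟩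
    rintro ⟨g, k⟩ ⟨⟨⟨hg, hν, he⟩, hQ⟩, ⟨h', hh', rfl⟩, hfe'⟩
    dsimp only at hg hν he hQ hfe' ⊢
    have hg' := (hM g).2 ⟨hg, hQ⟩
    have hl := (hM h').2 hh'
    have hAg : Aop p s f = g := by
      rw [hfe', Aop_add hg'.differentiable.continuous (hl.Lop ω).differentiable.continuous,
        hl.Aop_Lop ω, Aop_eq_self hν he]
      simp
    refine Prod.ext hAg.symm (funext fun w => ?_)
    have h1 := congrFun hfe w
    rw [hAg, hfe'] at h1
    exact add_left_cancel h1

/-- The restrictions `Å|_1`, `Å|_2` of `Å` to the μ-independent subspace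
`H^{2p+2}_ℓ(ℝ^{2p+1})` and to the subspace `P^{2p+2+s}_ℓ(ℝ^{2p+1})` of maps vanishing
at μ = 0 are projections, with ranges the corresponding equivariant subspaces, kernels
the ranges of the corresponding restrictions `L_{B,ν}|_1`, `L_{B,ν}|_2`, and the refined
direct-sum decompositions hold. -/
theorem restricted_averaging_projections_and_decompositions
    (p s ℓ : ℕ) (hp : 1 ≤ p) (hℓ : 2 ≤ ℓ)
    (ω : Fin p → ℝ) (hω : ∀ j, 0 < ω j)
    (hind : ∀ r : Fin p → ℚ, (∑ j, (r j : ℝ) * ω j) = 0 → ∀ j, r j = 0) :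
    -- Å|_1 and Å|_2 are projections
    (∀ f : W p s → V p, MemH p s ℓ f → MuIndep p s f →
        Aop p s (Aop p s f) = Aop p s f) ∧
    (∀ f : W p s → V p, MemH p s ℓ f → VanishMu p s f →
        Aop p s (Aop p s f) = Aop p s f) ∧
    -- range Å|_1 = H^{2p+1}_ℓ(ℝ^{2p+1}, T^p)
    ({g : W p s → V p | ∃ f, (MemH p s ℓ f ∧ MuIndep p s f) ∧ g = Aop p s f} =
      {g : W p s → V p |
        (MemH p s ℓ g ∧ NuIndep p s g ∧ Equivar p s g) ∧ MuIndep p s g}) ∧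
    -- range Å|_2 = P^{2p+1+s}_ℓ(ℝ^{2p+1}, T^p)
    ({g : W p s → V p | ∃ f, (MemH p s ℓ f ∧ VanishMu p s f) ∧ g = Aop p s f} =
      {g : W p s → V p |
        (MemH p s ℓ g ∧ NuIndep p s g ∧ Equivar p s g) ∧ VanishMu p s g}) ∧
    -- ker Å|_1 = range L_{B,ν}|_1
    ({f : W p s → V p | (MemH p s ℓ f ∧ MuIndep p s f) ∧ Aop p s f = fun _ => 0} =
      {f : W p s → V p | ∃ g, (MemH p s ℓ g ∧ MuIndep p s g) ∧ f = Lop p s ω g}) ∧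
    -- ker Å|_2 = range L_{B,ν}|_2
    ({f : W p s → V p | (MemH p s ℓ f ∧ VanishMu p s f) ∧ Aop p s f = fun _ => 0} =
      {f : W p s → V p | ∃ g, (MemH p s ℓ g ∧ VanishMu p s g) ∧ f = Lop p s ω g}) ∧
    -- H^{2p+2}_ℓ = H^{2p+1}_ℓ(T^p) ⊕ range L_{B,ν}|_1
    (∀ f : W p s → V p, MemH p s ℓ f → MuIndep p s f →
      ∃! gk : (W p s → V p) × (W p s → V p),
        ((MemH p s ℓ gk.1 ∧ NuIndep p s gk.1 ∧ Equivar p s gk.1) ∧ MuIndep p s gk.1) ∧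
        (∃ h, (MemH p s ℓ h ∧ MuIndep p s h) ∧ gk.2 = Lop p s ω h) ∧
        f = fun w => gk.1 w + gk.2 w) ∧
    -- P^{2p+2+s}_ℓ = P^{2p+1+s}_ℓ(T^p) ⊕ range L_{B,ν}|_2
    (∀ f : W p s → V p, MemH p s ℓ f → VanishMu p s f →
      ∃! gk : (W p s → V p) × (W p s → V p),
        ((MemH p s ℓ gk.1 ∧ NuIndep p s gk.1 ∧ Equivar p s gk.1) ∧ VanishMu p s gk.1) ∧
        (∃ h, (MemH p s ℓ h ∧ VanishMu p s h) ∧ gk.2 = Lop p s ω h) ∧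
        f = fun w => gk.1 w + gk.2 w) := by
  have h1 := averaging_projection_and_decomposition (ℓ := ℓ) hind
    (M := MemH p s ℓ) (Q := MuIndep p s) fun _ => memPoly_eq_zero_iff
  have h2 := averaging_projection_and_decomposition (ℓ := ℓ) hind
    (M := MemH p s ℓ) (Q := VanishMu p s) fun _ => memPoly_ne_zero_iff
  exact ⟨h1.1, h2.1, h1.2.1, h2.2.1, h1.2.2.1, h2.2.2.1, h1.2.2.2, h2.2.2.2⟩

end
end

section
/- Let h : (ℝ × ℂ^p) × ℝ × ℝ^s → ℝ be smooth and define g(x, ν, μ) = (d/ds)|_{s=0} h(x_0, e^{iω_1 s}x_1, …, e^{iω_p s}x_p, ν, μ), the derivative of h along the linear torus flow. If g is T^p-invariant, i.e. g(x_0, e^{iθ_1}x_1, …, e^{iθ_p}x_p, ν, μ) = g(x_0, x_1, …, x_p, ν, μ) for all θ_1, …, θ_p ∈ ℝ and all (x, ν, μ), then g is identically zero and h is itself T^p-invariant: h(x_0, e^{iθ_1}x_1, …, e^{iθ_p}x_p, ν, μ) = h(x_0, x_1, …, x_p, ν, μ) for all θ and all (x, ν, μ). -/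
noncomputable section

open Complex

section Equidistribution

open MeasureTheory UnitAddTorus

local instance : MeasureSpace UnitAddCircle := ⟨AddCircle.haarAddCircle⟩

local instance : Measure.IsAddHaarMeasure (volume : Measure UnitAddCircle) :=
  inferInstanceAs (Measure.IsAddHaarMeasure AddCircle.haarAddCircle)

lemma UnitAddTorus.mFourier_apply_add {d : Type*} [Fintype d] (n : d → ℤ) (x y : UnitAddTorus d) :
    mFourier n (x + y) = mFourier n x * mFourier n y := by
  simp [mFourier, fourier_apply, smul_add, AddCircle.toCircle_add, Finset.prod_mul_distrib]

/-- A translation under which `f` is invariant kills every Fourier coefficient whose character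
is nontrivial on it. -/
lemma UnitAddTorus.mFourierCoeff_eq_zero_of_translation {d : Type*} [Fintype d]
    (f : UnitAddTorus d → ℂ) (a : UnitAddTorus d) (hf : ∀ x, f (x + a) = f x) (n : d → ℤ)
    (ha : mFourier (-n) a ≠ 1) : mFourierCoeff f n = 0 := by
  have key : mFourierCoeff f n = mFourierCoeff f n * mFourier (-n) a := by
    calc mFourierCoeff f n = ∫ x, mFourier (-n) (x + a) • f (x + a) :=
          (integral_add_right_eq_self (fun x => mFourier (-n) x • f x) a).symm
      _ = ∫ x, (mFourier (-n) x • f x) * mFourier (-n) a := by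
          congr 1 with x
          rw [hf, mFourier_apply_add, smul_eq_mul, smul_eq_mul]
          ring
      _ = mFourierCoeff f n * mFourier (-n) a := integral_mul_const _ _
  by_contra h0
  exact ha (mul_left_cancel₀ h0 (by rw [← key, mul_one]))

/-- A continuous function on the torus whose nonzero Fourier coefficients vanish is constant. -/
lemma UnitAddTorus.eq_of_mFourierCoeff_eq_zero {d : Type*} [Fintype d] (f : C(UnitAddTorus d, ℂ))
    (hf : ∀ n, n ≠ 0 → mFourierCoeff f n = 0) (x y : UnitAddTorus d) : f x = f y := by
  have hs : Summable (mFourierCoeff f) :=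
    summable_of_ne_finset_zero (s := {0}) fun n hn => hf n (by simpa using hn)
  have hc (z) : f z = mFourierCoeff f 0 := by
    refine (hasSum_mFourier_series_apply_of_summable hs z).unique ?_
    convert hasSum_single (0 : d → ℤ) ?_ using 1
    · simp [mFourier_zero]
    · intro n hn
      simp [hf n hn]
  rw [hc x, hc y]

end Equidistribution

lemma UnitAddTorus.mFourier_apply_coe {d : Type*} [Fintype d] (n : d → ℤ) (a : d → ℝ) :
    mFourier n (fun j => (a j : UnitAddCircle)) =
      Complex.exp (2 * Real.pi * I * ((∑ j, n j * a j : ℝ) : ℂ)) := by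
  simp only [mFourier, ContinuousMap.coe_mk, fourier_coe_apply, ← Complex.exp_sum]
  congr 1
  push_cast
  rw [Finset.mul_sum]
  exact Finset.sum_congr rfl fun j _ => by ring

/-- A continuous function on the torus that is invariant under a linear flow with rationally
independent frequencies is constant. -/
lemma UnitAddTorus.eq_of_linear_flow_invariant {d : Type*} [Fintype d] (ω : d → ℝ)
    (hind : ∀ r : d → ℚ, (∑ j, (r j : ℝ) * ω j) = 0 → ∀ j, r j = 0)
    (f : C(UnitAddTorus d, ℂ))
    (hf : ∀ (σ : ℝ) (x : UnitAddTorus d), f (x + fun j => ((ω j * σ : ℝ) : UnitAddCircle)) = f x)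
    (x y : UnitAddTorus d) : f x = f y := by
  refine eq_of_mFourierCoeff_eq_zero f (fun n hn => ?_) x y
  have hk : (∑ j, (n j : ℝ) * ω j) ≠ 0 := fun h0 => hn <| funext fun j => by
    simpa using hind (fun j => n j) (by simpa using h0) j
  set k := ∑ j, (n j : ℝ) * ω j with hkdef
  refine mFourierCoeff_eq_zero_of_translation f _ (hf (-(1 / 2) / k)) n ?_
  have hsum : ∑ j, (((-n) j : ℤ) : ℝ) * (ω j * (-(1 / 2) / k)) = 1 / 2 := by
    calc _ = -(∑ j, (n j : ℝ) * ω j) * (-(1 / 2) / k) := by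
          rw [← Finset.sum_neg_distrib, Finset.sum_mul]
          exact Finset.sum_congr rfl fun j _ => by push_cast [Pi.neg_apply]; ring
      _ = 1 / 2 := by rw [← hkdef]; field_simp
  rw [mFourier_apply_coe, hsum]
  have : (2 * Real.pi * I * ((1 / 2 : ℝ) : ℂ)) = Real.pi * I := by push_cast; ring
  rw [this, Complex.exp_pi_mul_I]
  norm_num

lemma torusAct_add (p : ℕ) (θ φ : Fin p → ℝ) (x : V p) :
    torusAct p (θ + φ) x = torusAct p θ (torusAct p φ x) := by
  ext j
  · rfl
  · simp [torusAct, mul_add, Complex.exp_add, mul_assoc]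

lemma torusAct_zero (p : ℕ) (x : V p) : torusAct p 0 x = x := by
  ext j <;> simp [torusAct]

/-- The orbit map of `x`, as a map on the torus `(ℝ / ℤ)^p`. -/
def torusOrbit (p : ℕ) (x : V p) (t : UnitAddTorus (Fin p)) : V p :=
  (x.1, fun j => (AddCircle.toCircle (t j) : ℂ) * x.2 j)

lemma continuous_torusOrbit (p : ℕ) (x : V p) : Continuous (torusOrbit p x) := by
  have := AddCircle.continuous_toCircle (T := 1)
  unfold torusOrbit
  fun_prop

lemma torusOrbit_coe (p : ℕ) (x : V p) (a : Fin p → ℝ) :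
    torusOrbit p x (fun j => (a j : UnitAddCircle)) = torusAct p (fun j => 2 * Real.pi * a j) x := by
  ext j
  · rfl
  · simp [torusOrbit, torusAct, AddCircle.toCircle_apply_mk, Circle.coe_exp, mul_comm I]

lemma exists_coe_eq {p : ℕ} (t : UnitAddTorus (Fin p)) :
    ∃ a : Fin p → ℝ, (fun j => (a j : UnitAddCircle)) = t :=
  ⟨fun j => (t j).out, funext fun j => Quotient.out_eq' (t j)⟩

lemma torusAct_eq_torusOrbit (p : ℕ) (θ : Fin p → ℝ) (x : V p) :
    torusAct p θ x = torusOrbit p x (fun j => ((θ j / (2 * Real.pi) : ℝ) : UnitAddCircle)) := by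
  rw [torusOrbit_coe]
  congr 1 with j
  field_simp

/-- A function with constant derivative and bounded range has zero derivative. -/
lemma eq_zero_of_hasDerivAt_const_of_bounded {f : ℝ → ℝ} {c C : ℝ}
    (hf : ∀ σ, HasDerivAt f c σ) (hC : ∀ σ, |f σ| ≤ C) : c = 0 := by
  have hlin (σ : ℝ) : f σ = f 0 + c * σ := by
    have hd (τ : ℝ) : HasDerivAt (fun τ => f τ - c * τ) 0 τ := by
      have := (hf τ).sub ((hasDerivAt_id τ).const_mul c)
      rwa [mul_one, sub_self] at this
    have := is_const_of_deriv_eq_zero (fun τ => (hd τ).differentiableAt) (fun τ => (hd τ).deriv) σ 0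
    simp only [mul_zero, sub_zero] at this
    linarith
  by_contra hc
  have h1 := hC ((2 * C + 1) / c)
  have h0 := hC 0
  rw [hlin, mul_div_cancel₀ _ hc] at h1
  have := neg_le_of_abs_le h0
  have := le_of_abs_le h1
  have := (abs_nonneg _).trans h0
  linarith

/-- Let `h` be smooth and let `g` be the derivative of `h` along the
linear torus flow.  If `g` is `T^p`-invariant, then `g ≡ 0` and `h` is `T^p`-invariant. -/
theorem derivative_along_flow_invariant
    (p s : ℕ) (hp : 1 ≤ p) (ω : Fin p → ℝ) (hω : ∀ j, 0 < ω j)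
    (hind : ∀ r : Fin p → ℚ, (∑ j, (r j : ℝ) * ω j) = 0 → ∀ j, r j = 0)
    (h : W p s → ℝ) (hsm : ContDiff ℝ (⊤ : ℕ∞) h)
    (g : W p s → ℝ)
    (hg : ∀ w : W p s, g w =
      deriv (fun σ : ℝ => h (torusAct p (fun j => ω j * σ) w.1, w.2)) 0)
    (hginv : ∀ (θ : Fin p → ℝ) (x : V p) (ν : ℝ) (μ : Fin s → ℝ),
      g (torusAct p θ x, ν, μ) = g (x, ν, μ)) :
    (∀ w, g w = 0) ∧
    ∀ (θ : Fin p → ℝ) (x : V p) (ν : ℝ) (μ : Fin s → ℝ),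
      h (torusAct p θ x, ν, μ) = h (x, ν, μ) := by
  have hact (σ τ : ℝ) (x : V p) : torusAct p (fun j => ω j * (σ + τ)) x =
      torusAct p (fun j => ω j * τ) (torusAct p (fun j => ω j * σ) x) := by
    rw [← torusAct_add]
    congr 1 with j
    simp only [Pi.add_apply]
    ring
  have hflow (w : W p s) (σ : ℝ) :
      HasDerivAt (fun σ : ℝ => h (torusAct p (fun j => ω j * σ) w.1, w.2)) (g w) σ := by
    have hdiff : Differentiable ℝ (fun σ : ℝ => h (torusAct p (fun j => ω j * σ) w.1, w.2)) := by
      refine (hsm.differentiable (by simp)).comp ?_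
      have : Differentiable ℝ fun σ : ℝ => (σ : ℂ) := Complex.ofRealCLM.differentiable
      unfold torusAct
      simp only [Complex.ofReal_mul]
      fun_prop
    have hderiv : g w = deriv (fun σ : ℝ => h (torusAct p (fun j => ω j * σ) w.1, w.2)) σ := by
      rw [← hginv (fun j => ω j * σ) w.1 w.2.1 w.2.2, hg]
      simp only [← hact]
      rw [deriv_comp_const_add (fun τ => h (torusAct p (fun j => ω j * τ) w.1, w.2)) σ 0, add_zero]
    rw [hderiv]
    exact (hdiff σ).hasDerivAt
  have hcont (w : W p s) : Continuous fun t => h (torusOrbit p w.1 t, w.2) :=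
    hsm.continuous.comp ((continuous_torusOrbit p w.1).prodMk continuous_const)
  have hzero (w : W p s) : g w = 0 := by
    obtain ⟨C, hC⟩ := (isCompact_range (hcont w)).isBounded.exists_norm_le
    refine eq_zero_of_hasDerivAt_const_of_bounded (hflow w) (C := C) fun σ => hC _ ?_
    rw [torusAct_eq_torusOrbit]
    exact Set.mem_range_self _
  have hinv (w : W p s) (σ : ℝ) : h (torusAct p (fun j => ω j * σ) w.1, w.2) = h w := by
    have := is_const_of_deriv_eq_zero (fun τ => (hflow w τ).differentiableAt)
      (fun τ => (hflow w τ).deriv.trans (hzero w)) σ 0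
    simp only [mul_zero] at this
    rw [this]
    exact congrArg (fun x => h (x, w.2)) (torusAct_zero p w.1)
  refine ⟨hzero, fun θ x ν μ => ?_⟩
  have hconst := UnitAddTorus.eq_of_linear_flow_invariant ω hind
    ⟨fun t => (h (torusOrbit p x t, ν, μ) : ℂ), Complex.continuous_ofReal.comp (hcont (x, ν, μ))⟩
    (by
      intro σ t
      obtain ⟨a, rfl⟩ := exists_coe_eq t
      simp only [ContinuousMap.coe_mk, Complex.ofReal_inj]
      have hsum : ((fun j => (a j : UnitAddCircle)) + fun j => ((ω j * σ : ℝ) : UnitAddCircle)) =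
          fun j => ((a j + ω j * σ : ℝ) : UnitAddCircle) := rfl
      rw [hsum, torusOrbit_coe, torusOrbit_coe,
        ← hinv (torusAct p (fun j => 2 * Real.pi * a j) x, ν, μ) (2 * Real.pi * σ), ← torusAct_add]
      congr 3 with j
      simp only [Pi.add_apply]
      ring)
    (fun j => ((θ j / (2 * Real.pi) : ℝ) : UnitAddCircle))
    (fun j => (((0 : Fin p → ℝ) j / (2 * Real.pi) : ℝ) : UnitAddCircle))
  simp only [ContinuousMap.coe_mk, Complex.ofReal_inj] at hconst
  rwa [← torusAct_eq_torusOrbit, ← torusAct_eq_torusOrbit, torusAct_zero] at hconst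

end
end
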